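/- Let X, Y be order-D real tensors of the same size. The equalities ⟨X, Y⟩ = ∑_{k=1}^{n d} σ^(d)_k(X) · σ^(d)_k(Y) hold simultaneously for all modes d = 1,…,D if and only if for every d there exist orthogonal matrices U^(d) ∈ ℝ^{n_d × n_d} and V^(d) (square, of the size of the column index of the mode-d matricization) such that X_(d) = U^(d) · Diag(σ^(d)(X)) · (V^(d))ᵀ and Y_(d) = U^(d) · Diag(σ^(d)(Y)) · (V^(d))ᵀ, where Diag(σ^(d)(Z)) is the rectangular diagonal matrix carrying the mode-d singular values of Z in nonincreasing order on its diagonal. -/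

import Mathlib

open scoped BigOperators Matrix

/-- The entries of `v` sorted in nonincreasing order. -/
noncomputable def sortDesc {m : ℕ} (v : Fin m → ℝ) : Fin m → ℝ :=
  fun k => (v ∘ Tuple.sort v) k.rev

theorem gram_isHermitian {m : ℕ} {J : Type*} [Fintype J]
    (A : Matrix (Fin m) J ℝ) : (A * Aᵀ).IsHermitian := by
  ext i j
  simp [Matrix.conjTranspose_apply, Matrix.mul_apply, Matrix.transpose_apply, mul_comm]

/-- Singular values of a real matrix `A`: the square roots of the eigenvalues of
the positive semidefinite matrix `A * Aᵀ`, in nonincreasing order. -/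
noncomputable def singularValues {m : ℕ} {J : Type*} [Fintype J]
    (A : Matrix (Fin m) J ℝ) : Fin m → ℝ :=
  fun k => Real.sqrt (sortDesc (gram_isHermitian A).eigenvalues k)

variable {D : ℕ} {n : Fin D → ℕ}

/-- Inner product of two tensors. -/
noncomputable def tinner (X Y : (∀ d, Fin (n d)) → ℝ) : ℝ :=
  ∑ i : ∀ d, Fin (n d), X i * Y i

/-- Mode-`d` matricization of the tensor `X`. -/
def matricize (X : (∀ d, Fin (n d)) → ℝ) (d : Fin D) :
    Matrix (Fin (n d)) (∀ d' : {d' : Fin D // d' ≠ d}, Fin (n d')) ℝ :=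
  Matrix.of fun k j =>
    X (fun d' => if h : d' = d then Fin.cast (congrArg n h.symm) k else j ⟨d', h⟩)

/-- Mode-`d` singular values of a tensor. -/
noncomputable def modeSV (X : (∀ d, Fin (n d)) → ℝ) (d : Fin D) : Fin (n d) → ℝ :=
  singularValues (matricize X d)

/-- The multilinear (Tucker) product `X ×₁ U 1 ×₂ ⋯ ×_D U D`. -/
noncomputable def tuckerMul (X : (∀ d, Fin (n d)) → ℝ)
    (U : ∀ d, Matrix (Fin (n d)) (Fin (n d)) ℝ) : (∀ d, Fin (n d)) → ℝ :=
  fun i => ∑ j : ∀ d, Fin (n d), (∏ d, U d (i d) (j d)) * X j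

/-- Rectangular "diagonal" matrix with columns indexed by an arbitrary fintype,
identified with an initial segment of `ℕ` via `Fintype.equivFin`. -/
noncomputable def rectDiagJ {m : ℕ} {J : Type*} [Fintype J]
    (v : Fin m → ℝ) : Matrix (Fin m) J ℝ :=
  Matrix.of fun k j => if ((Fintype.equivFin J) j : ℕ) = (k : ℕ) then v k else 0

/-- If `M` is doubly stochastic and `s`, `t` are similarly ordered, then the bilinear form of `M`
at `s`, `t` is at most `∑ i, s i * t i`. -/
theorem Monovary.sum_sum_mul_doublyStochastic_le {ι : Type*} [Fintype ι] [DecidableEq ι]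
    {s t : ι → ℝ} (hst : Monovary s t) {M : Matrix ι ι ℝ} (hM : M ∈ doublyStochastic ℝ ι) :
    ∑ i, ∑ j, s i * t j * M i j ≤ ∑ i, s i * t i := by
  rw [← SetLike.mem_coe, doublyStochastic_eq_convexHull_permMatrix] at hM
  let L : Matrix ι ι ℝ →ₗ[ℝ] ℝ :=
    { toFun := fun M => ∑ i, ∑ j, s i * t j * M i j
      map_add' := fun M N => by simp [mul_add, Finset.sum_add_distrib]
      map_smul' := fun c M => by
        simp only [Matrix.smul_apply, smul_eq_mul, RingHom.id_apply, Finset.mul_sum]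
        exact Finset.sum_congr rfl fun i _ => Finset.sum_congr rfl fun j _ => by ring }
  refine convexHull_min (t := {M | L M ≤ ∑ i, s i * t i}) ?_
    (convex_halfSpace_le L.isLinear _) hM
  rintro _ ⟨σ, rfl⟩
  simpa [L, Equiv.Perm.permMatrix, PEquiv.toMatrix_apply] using hst.sum_mul_comp_perm_le_sum_mul

/-- The entrywise square of an orthogonal matrix is doubly stochastic. -/
theorem Matrix.sq_mem_doublyStochastic {ι : Type*} [Fintype ι] [DecidableEq ι]
    {P : Matrix ι ι ℝ} (hP : P * Pᵀ = 1) :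
    (Matrix.of fun i j => P i j ^ 2) ∈ doublyStochastic ℝ ι := by
  have hP' : Pᵀ * P = 1 := mul_eq_one_comm.mp hP
  refine mem_doublyStochastic_iff_sum.mpr ⟨fun i j => sq_nonneg _, fun i => ?_, fun j => ?_⟩
  · simpa [Matrix.mul_apply, sq] using congrFun (congrFun hP i) i
  · simpa [Matrix.mul_apply, sq] using congrFun (congrFun hP' j) j

/-- Two orthogonal changes of basis increase the inner product of two rectangular diagonal
matrices with nonincreasing nonnegative diagonals to at most the inner product of the diagonals. -/
theorem trace_rectDiagJ_mul_le {m : ℕ} {J : Type*} [Fintype J] [DecidableEq J] {s t : Fin m → ℝ}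
    (hs : Antitone s) (ht : Antitone t) (hs0 : 0 ≤ s) (ht0 : 0 ≤ t)
    {P : Matrix (Fin m) (Fin m) ℝ} {Q : Matrix J J ℝ} (hP : P * Pᵀ = 1) (hQ : Q * Qᵀ = 1) :
    (rectDiagJ (J := J) s * Q * (rectDiagJ (J := J) t)ᵀ * Pᵀ).trace ≤ ∑ k, s k * t k := by
  set ε : Fin m → J → ℝ := fun k j => if (Fintype.equivFin J j : ℕ) = k then 1 else 0 with hε
  have hε0 : ∀ k j, 0 ≤ ε k j := fun k j => by simp only [hε]; split_ifs <;> norm_num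
  have hε1 : ∀ k, ∑ j, ε k j ≤ 1 := fun k => by
    simp only [hε, Finset.sum_boole]
    norm_cast
    refine Finset.card_le_one.mpr fun a ha b hb => ?_
    simp only [Finset.mem_filter, Finset.mem_univ, true_and] at ha hb
    exact (Fintype.equivFin J).injective (Fin.ext (ha.trans hb.symm))
  have hdiag : ∀ (v : Fin m → ℝ) k j, rectDiagJ (J := J) v k j = v k * ε k j :=
    fun v k j => by simp [rectDiagJ, hε]
  have hεε : ∀ k l j, ε k j * ε l j = if k = l then ε k j else 0 := fun k l j => by
    simp only [hε]
    grind [Fin.ext_iff]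
  let ext : (Fin m → ℝ) → J → ℝ := fun v j => ∑ k, v k * ε k j
  have hext : ∀ v j, ext v j =
      if h : (Fintype.equivFin J j : ℕ) < m then v ⟨_, h⟩ else 0 := fun v j => by
    simp only [ext, hε, mul_ite, mul_one, mul_zero]
    split_ifs with h
    · rw [Finset.sum_eq_single (⟨_, h⟩ : Fin m)]
      · simp
      · intro b _ hb
        rw [if_neg]
        exact fun h' => hb (Fin.ext h'.symm)
      · simp
    · exact Finset.sum_eq_zero fun k _ => if_neg fun h' => h (h'.trans_lt k.2)
  have hanti : ∀ v : Fin m → ℝ, Antitone v → 0 ≤ v → ∀ i j : J,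
      (Fintype.equivFin J i : ℕ) ≤ Fintype.equivFin J j → ext v j ≤ ext v i := by
    intro v hv hv0 i j hij
    rw [hext, hext]
    split_ifs with h1 h2 h2
    · exact hv hij
    · omega
    · exact hv0 _
    · exact le_rfl
  have hmono : Monovary (ext s) (ext t) := fun i j hij =>
    hanti s hs hs0 j i (le_of_not_ge fun h => absurd (hanti t ht ht0 i j h) (not_le.mpr hij))
  have hPsum := (hs.monovary ht).sum_sum_mul_doublyStochastic_le (Matrix.sq_mem_doublyStochastic hP)
  have hQsum := hmono.sum_sum_mul_doublyStochastic_le (Matrix.sq_mem_doublyStochastic hQ)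
  simp only [Matrix.of_apply] at hPsum hQsum
  have hdiagsum : ∑ j, ext s j * ext t j ≤ ∑ k, s k * t k := by
    calc ∑ j, ext s j * ext t j = ∑ j, ∑ k, s k * t k * ε k j := by
          refine Finset.sum_congr rfl fun j _ => ?_
          simp only [ext, Finset.sum_mul_sum]
          refine Finset.sum_congr rfl fun k _ => ?_
          have : ∀ l, s k * ε k j * (t l * ε l j) = if k = l then s k * t l * ε k j else 0 := by
            intro l
            rw [mul_mul_mul_comm, hεε]
            split_ifs <;> simp
          simp [this]
      _ = ∑ k, s k * t k * ∑ j, ε k j := by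
          rw [Finset.sum_comm]
          simp only [Finset.mul_sum]
      _ ≤ _ := Finset.sum_le_sum fun k _ =>
          mul_le_of_le_one_right (mul_nonneg (hs0 k) (ht0 k)) (hε1 k)
  have htrace : (rectDiagJ (J := J) s * Q * (rectDiagJ (J := J) t)ᵀ * Pᵀ).trace
      = ∑ k, ∑ l, ∑ j', ∑ j, s k * t l * (ε k j * ε l j') * (P k l * Q j j') := by
    simp only [Matrix.trace, Matrix.diag_apply, Matrix.mul_apply, Matrix.transpose_apply, hdiag,
      Finset.sum_mul]
    refine Finset.sum_congr rfl fun k _ => Finset.sum_congr rfl fun l _ =>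
      Finset.sum_congr rfl fun j' _ => Finset.sum_congr rfl fun j _ => by ring
  have hle : (rectDiagJ (J := J) s * Q * (rectDiagJ (J := J) t)ᵀ * Pᵀ).trace ≤
      (∑ k, ∑ l, ∑ j', ∑ j, s k * t l * (ε k j * ε l j') * P k l ^ 2
        + ∑ k, ∑ l, ∑ j', ∑ j, s k * t l * (ε k j * ε l j') * Q j j' ^ 2) / 2 := by
    rw [htrace]
    simp only [← Finset.sum_add_distrib, Finset.sum_div]
    gcongr with k _ l _ j' _ j _
    have h0 : 0 ≤ s k * t l * (ε k j * ε l j') :=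
      mul_nonneg (mul_nonneg (hs0 k) (ht0 l)) (mul_nonneg (hε0 _ _) (hε0 _ _))
    nlinarith [mul_nonneg h0 (sq_nonneg (P k l - Q j j'))]
  have h1 : ∑ k, ∑ l, ∑ j', ∑ j, s k * t l * (ε k j * ε l j') * P k l ^ 2
      ≤ ∑ k, ∑ l, s k * t l * P k l ^ 2 := by
    gcongr with k _ l _
    have : ∑ j', ∑ j, s k * t l * (ε k j * ε l j') * P k l ^ 2
        = s k * t l * P k l ^ 2 * ((∑ j, ε k j) * ∑ j', ε l j') := by
      rw [Finset.sum_mul_sum, Finset.sum_comm, Finset.mul_sum]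
      simp only [Finset.mul_sum]
      exact Finset.sum_congr rfl fun _ _ => Finset.sum_congr rfl fun _ _ => by ring
    rw [this]
    exact mul_le_of_le_one_right
      (mul_nonneg (mul_nonneg (hs0 k) (ht0 l)) (sq_nonneg _))
      (mul_le_one₀ (hε1 k) (Finset.sum_nonneg fun j _ => hε0 l j) (hε1 l))
  have h2 : ∑ k, ∑ l, ∑ j', ∑ j, s k * t l * (ε k j * ε l j') * Q j j' ^ 2
      = ∑ j, ∑ j', ext s j * ext t j' * Q j j' ^ 2 := by
    simp only [ext, Finset.sum_mul_sum]
    simp only [Finset.sum_mul]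
    calc _ = ∑ k, ∑ l, ∑ j, ∑ j', s k * ε k j * (t l * ε l j') * Q j j' ^ 2 := by
          refine Finset.sum_congr rfl fun k _ => Finset.sum_congr rfl fun l _ => ?_
          rw [Finset.sum_comm]
          exact Finset.sum_congr rfl fun _ _ => Finset.sum_congr rfl fun _ _ => by ring
      _ = ∑ k, ∑ j, ∑ j', ∑ l, s k * ε k j * (t l * ε l j') * Q j j' ^ 2 := by
          refine Finset.sum_congr rfl fun k _ => ?_
          rw [Finset.sum_comm]
          exact Finset.sum_congr rfl fun j _ => Finset.sum_comm
      _ = _ := by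
          rw [Finset.sum_comm]
          refine Finset.sum_congr rfl fun j _ => ?_
          rw [Finset.sum_comm]
  linarith

/-- A matrix with orthogonal rows of norms `σ 0 ≥ σ 1 ≥ ⋯` is a rectangular diagonal matrix times
an orthogonal matrix. -/
theorem exists_eq_rectDiagJ_mul_of_mul_transpose {m : ℕ} {J : Type*} [Fintype J] [DecidableEq J]
    {W : Matrix (Fin m) J ℝ} {σ : Fin m → ℝ} (hσ : Antitone σ) (hσ0 : 0 ≤ σ)
    (hW : W * Wᵀ = Matrix.diagonal fun k => σ k ^ 2) :
    ∃ V : Matrix J J ℝ, V * Vᵀ = 1 ∧ W = rectDiagJ (J := J) σ * Vᵀ := by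
  have hrow : ∀ k l, ∑ i, W k i * W l i = if k = l then σ k ^ 2 else 0 := fun k l => by
    simpa [Matrix.mul_apply, Matrix.diagonal_apply] using congrFun (congrFun hW k) l
  have hzero : ∀ k : Fin m, Fintype.card J ≤ k → σ k = 0 := by
    intro k hk
    by_contra hne
    have hrank : (W * Wᵀ).rank ≤ Fintype.card J :=
      (Matrix.rank_mul_le_left _ _).trans (Matrix.rank_le_card_width _)
    rw [hW, Matrix.rank_diagonal, Fintype.card_subtype] at hrank
    have hsub : Finset.Iic k ⊆ Finset.univ.filter fun i => σ i ^ 2 ≠ 0 := by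
      intro i hi
      have hpos : 0 < σ k := lt_of_le_of_ne (hσ0 k) (Ne.symm hne)
      have : 0 < σ i := hpos.trans_le (hσ (Finset.mem_Iic.mp hi))
      simp [this.ne']
    have := Finset.card_le_card hsub
    rw [Fin.card_Iic] at this
    omega
  let e := Fintype.equivFin J
  let v : J → EuclideanSpace ℝ J := fun j =>
    if h : (e j : ℕ) < m then (σ ⟨_, h⟩)⁻¹ • WithLp.toLp 2 (W ⟨_, h⟩) else 0
  let S : Set J := {j | ∃ h : (e j : ℕ) < m, σ ⟨_, h⟩ ≠ 0}
  have hv : Orthonormal ℝ (S.domRestrict v) := by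
    rw [orthonormal_iff_ite]
    rintro ⟨i, hi, hi0⟩ ⟨j, hj, hj0⟩
    simp only [Set.domRestrict_apply]
    have hvi : v i = (σ ⟨_, hi⟩)⁻¹ • WithLp.toLp 2 (W ⟨_, hi⟩) := dif_pos hi
    have hvj : v j = (σ ⟨_, hj⟩)⁻¹ • WithLp.toLp 2 (W ⟨_, hj⟩) := dif_pos hj
    rw [hvi, hvj, inner_smul_left, inner_smul_right, EuclideanSpace.inner_eq_star_dotProduct]
    simp only [dotProduct, star_trivial, hrow]
    by_cases hij : i = j
    · subst hij
      simp
      field_simp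
    · have hne : ¬ (e j : ℕ) = e i := fun h => hij (e.injective (Fin.ext h.symm))
      simp [hij, hne]
  obtain ⟨b, hb⟩ := hv.exists_orthonormalBasis_extension_of_card_eq (by simp)
  refine ⟨Matrix.of fun i j => b j i, ?_, ?_⟩
  · rw [mul_eq_one_comm]
    ext i j
    have := orthonormal_iff_ite.mp b.orthonormal i j
    rw [EuclideanSpace.inner_eq_star_dotProduct] at this
    simpa [Matrix.mul_apply, dotProduct, Matrix.one_apply, mul_comm] using this
  · ext k i
    rw [Matrix.mul_apply]
    simp only [Matrix.transpose_apply, Matrix.of_apply, rectDiagJ]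
    by_cases h0 : σ k = 0
    · have hk := hrow k k
      rw [if_pos rfl, h0, zero_pow two_ne_zero,
        Finset.sum_eq_zero_iff_of_nonneg fun i _ => mul_self_nonneg _] at hk
      simpa [h0] using hk i
    · have hk : (k : ℕ) < Fintype.card J := lt_of_not_ge fun h => h0 (hzero k h)
      rw [Finset.sum_eq_single (e.symm ⟨k, hk⟩)]
      · have hm : (e (e.symm ⟨k, hk⟩) : ℕ) = k := by simp
        have hmem : e.symm ⟨k, hk⟩ ∈ S := ⟨by simp, by simpa using h0⟩
        rw [hb _ hmem]
        simp [v, e, h0]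
      · intro j _ hj
        rw [if_neg, zero_mul]
        exact fun h => hj (by rw [Equiv.eq_symm_apply]; exact Fin.ext h)
      · simp

section SingularValues

variable {m : ℕ} {J : Type*} [Fintype J]

theorem singularValues_nonneg (A : Matrix (Fin m) J ℝ) : 0 ≤ singularValues A :=
  fun _ => Real.sqrt_nonneg _

theorem singularValues_antitone (A : Matrix (Fin m) J ℝ) : Antitone (singularValues A) :=
  fun _ _ h => Real.sqrt_le_sqrt (Tuple.monotone_sort _ (Fin.rev_le_rev.mpr h))

theorem exists_perm_sq_singularValues (A : Matrix (Fin m) J ℝ) :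
    ∃ π : Equiv.Perm (Fin m),
      ∀ k, singularValues A k ^ 2 = (gram_isHermitian A).eigenvalues (π k) := by
  refine ⟨Fin.revPerm.trans (Tuple.sort _), fun k => Real.sq_sqrt ?_⟩
  have hpos : (A * Aᵀ).PosSemidef := Matrix.posSemidef_self_mul_conjTranspose A
  exact hpos.eigenvalues_nonneg _

theorem sum_sq_singularValues (A : Matrix (Fin m) J ℝ) :
    ∑ k, singularValues A k ^ 2 = (A * Aᵀ).trace := by
  obtain ⟨π, hπ⟩ := exists_perm_sq_singularValues A
  simp only [hπ]
  rw [Equiv.sum_comp π, (gram_isHermitian A).trace_eq_sum_eigenvalues]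
  simp

/-- Singular value decomposition. -/
theorem exists_svd [DecidableEq J] (A : Matrix (Fin m) J ℝ) :
    ∃ (U : Matrix (Fin m) (Fin m) ℝ) (V : Matrix J J ℝ),
      U * Uᵀ = 1 ∧ V * Vᵀ = 1 ∧ A = U * rectDiagJ (J := J) (singularValues A) * Vᵀ := by
  obtain ⟨π, hπ⟩ := exists_perm_sq_singularValues A
  have hA := gram_isHermitian A
  set E : Matrix (Fin m) (Fin m) ℝ := hA.eigenvectorUnitary.1
  have hEE : Eᵀ * E = 1 := Matrix.mem_unitaryGroup_iff'.mp hA.eigenvectorUnitary.2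
  have hdiag : Eᵀ * (A * Aᵀ) * E = Matrix.diagonal hA.eigenvalues := by
    have h := hA.spectral_theorem
    rw [Unitary.conjStarAlgAut_apply] at h
    have h' : A * Aᵀ = E * Matrix.diagonal hA.eigenvalues * Eᵀ := h
    calc Eᵀ * (A * Aᵀ) * E = Eᵀ * (E * Matrix.diagonal hA.eigenvalues * Eᵀ) * E := by
          exact congrArg (fun M => Eᵀ * M * E) h'
      _ = (Eᵀ * E) * Matrix.diagonal hA.eigenvalues * (Eᵀ * E) := by
          simp only [Matrix.mul_assoc]
      _ = _ := by rw [hEE, Matrix.one_mul, Matrix.mul_one]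
  set U : Matrix (Fin m) (Fin m) ℝ := E.submatrix id π with hU
  have hUU : Uᵀ * U = 1 := by
    have : Uᵀ * U = (Eᵀ * E).submatrix π π := by ext; simp [hU, Matrix.mul_apply]
    rw [this, hEE, Matrix.submatrix_one_equiv]
  have hUU' : U * Uᵀ = 1 := mul_eq_one_comm.mp hUU
  have hW : (Uᵀ * A) * (Uᵀ * A)ᵀ = Matrix.diagonal fun k => singularValues A k ^ 2 := by
    have : (Uᵀ * A) * (Uᵀ * A)ᵀ = (Eᵀ * (A * Aᵀ) * E).submatrix π π := by
      rw [Matrix.transpose_mul, Matrix.transpose_transpose, Matrix.mul_assoc, ← Matrix.mul_assoc A,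
        ← Matrix.mul_assoc]
      ext; simp [hU, Matrix.mul_apply]
    rw [this, hdiag, Matrix.submatrix_diagonal_equiv]
    simp only [hπ, Function.comp_def]
  obtain ⟨V, hV, hWV⟩ := exists_eq_rectDiagJ_mul_of_mul_transpose (singularValues_antitone A)
    (singularValues_nonneg A) hW
  refine ⟨U, V, hUU', hV, ?_⟩
  rw [Matrix.mul_assoc, ← hWV, ← Matrix.mul_assoc, hUU', Matrix.one_mul]

theorem trace_mul_svd_transpose_le [DecidableEq J] (A : Matrix (Fin m) J ℝ)
    {U' : Matrix (Fin m) (Fin m) ℝ} {V' : Matrix J J ℝ} (hU' : U' * U'ᵀ = 1) (hV' : V' * V'ᵀ = 1)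
    {t : Fin m → ℝ} (ht : Antitone t) (ht0 : 0 ≤ t) :
    (A * (U' * rectDiagJ (J := J) t * V'ᵀ)ᵀ).trace ≤ ∑ k, singularValues A k * t k := by
  obtain ⟨U, V, hU, hV, hA⟩ := exists_svd A
  have hP : (Uᵀ * U') * (Uᵀ * U')ᵀ = 1 := by
    rw [Matrix.transpose_mul, Matrix.transpose_transpose, Matrix.mul_assoc, ← Matrix.mul_assoc U',
      hU', Matrix.one_mul, mul_eq_one_comm.mp hU]
  have hQ : (Vᵀ * V') * (Vᵀ * V')ᵀ = 1 := by
    rw [Matrix.transpose_mul, Matrix.transpose_transpose, Matrix.mul_assoc, ← Matrix.mul_assoc V',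
      hV', Matrix.one_mul, mul_eq_one_comm.mp hV]
  have h := trace_rectDiagJ_mul_le (singularValues_antitone A) ht (singularValues_nonneg A) ht0
    hP hQ
  refine le_of_eq_of_le ?_ h
  conv_lhs => rw [hA]
  simp only [Matrix.transpose_mul, Matrix.transpose_transpose, Matrix.mul_assoc]
  rw [Matrix.trace_mul_comm]
  simp only [Matrix.mul_assoc]

/-- Von Neumann's trace inequality. -/
theorem trace_mul_transpose_le_sum_singularValues (A B : Matrix (Fin m) J ℝ) :
    (A * Bᵀ).trace ≤ ∑ k, singularValues A k * singularValues B k := by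
  classical
  obtain ⟨U, V, hU, hV, hB⟩ := exists_svd B
  have h := trace_mul_svd_transpose_le A hU hV (singularValues_antitone B)
    (singularValues_nonneg B)
  rwa [← hB] at h

theorem trace_svd_mul_svd_transpose [DecidableEq J] {U : Matrix (Fin m) (Fin m) ℝ}
    {V : Matrix J J ℝ} (hU : U * Uᵀ = 1) (hV : V * Vᵀ = 1) (s t : Fin m → ℝ) :
    (U * rectDiagJ (J := J) s * Vᵀ *
      (U * rectDiagJ (J := J) t * Vᵀ)ᵀ).trace
      = ∑ k : Fin m, if (k : ℕ) < Fintype.card J then s k * t k else 0 := by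
  have h : U * rectDiagJ (J := J) s * Vᵀ *
        (U * rectDiagJ (J := J) t * Vᵀ)ᵀ
      = U * (rectDiagJ (J := J) s * (rectDiagJ (J := J) t)ᵀ * Uᵀ) := by
    simp only [Matrix.transpose_mul, Matrix.transpose_transpose, Matrix.mul_assoc]
    rw [← Matrix.mul_assoc Vᵀ V, mul_eq_one_comm.mp hV, Matrix.one_mul]
  rw [h, Matrix.trace_mul_comm, Matrix.mul_assoc, mul_eq_one_comm.mp hU, Matrix.mul_one]
  simp only [Matrix.trace, Matrix.diag_apply, Matrix.mul_apply, Matrix.transpose_apply, rectDiagJ,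
    Matrix.of_apply]
  refine Finset.sum_congr rfl fun k _ => ?_
  split_ifs with hk
  · rw [Finset.sum_eq_single ((Fintype.equivFin J).symm ⟨k, hk⟩)]
    · simp
    · intro j _ hj
      rw [if_neg, zero_mul]
      exact fun h => hj (by rw [Equiv.eq_symm_apply]; exact Fin.ext h)
    · simp
  · refine Finset.sum_eq_zero fun j _ => ?_
    rw [if_neg, zero_mul]
    exact fun h => hk (h ▸ (Fintype.equivFin J j).2)

theorem singularValues_eq_zero_of_card_le (A : Matrix (Fin m) J ℝ) {k : Fin m}
    (hk : Fintype.card J ≤ k) : singularValues A k = 0 := by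
  classical
  obtain ⟨U, V, hU, hV, hA⟩ := exists_svd A
  have h := sum_sq_singularValues A
  have hA' := trace_svd_mul_svd_transpose hU hV (singularValues A) (singularValues A)
  rw [← hA] at hA'
  rw [hA'] at h
  have hle : ∀ i ∈ (Finset.univ : Finset (Fin m)), (if (i : ℕ) < Fintype.card J then
      singularValues A i * singularValues A i else 0) ≤ singularValues A i ^ 2 := by
    intro i _
    split_ifs
    · exact (sq _).ge
    · exact sq_nonneg _
  have hk' := (Finset.sum_eq_sum_iff_of_le hle).mp h.symm k (Finset.mem_univ k)
  rw [if_neg (not_lt.mpr hk)] at hk'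
  exact pow_eq_zero_iff two_ne_zero |>.mp hk'.symm

theorem trace_svd_mul_svd_transpose_singularValues [DecidableEq J]
    {U : Matrix (Fin m) (Fin m) ℝ} {V : Matrix J J ℝ} (hU : U * Uᵀ = 1) (hV : V * Vᵀ = 1)
    (A B : Matrix (Fin m) J ℝ) :
    (U * rectDiagJ (J := J) (singularValues A) * Vᵀ *
      (U * rectDiagJ (J := J) (singularValues B) * Vᵀ)ᵀ).trace
      = ∑ k, singularValues A k * singularValues B k := by
  rw [trace_svd_mul_svd_transpose hU hV]
  refine Finset.sum_congr rfl fun k _ => ?_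
  split_ifs with hk
  · rfl
  · rw [singularValues_eq_zero_of_card_le A (not_lt.mp hk), zero_mul]

theorem eq_of_trace_mul_transpose_le {A B : Matrix (Fin m) J ℝ}
    (h : (A * Aᵀ).trace + (B * Bᵀ).trace ≤ 2 * (A * Bᵀ).trace) : A = B := by
  have hcomm : (B * Aᵀ).trace = (A * Bᵀ).trace := by
    rw [← Matrix.trace_transpose, Matrix.transpose_mul, Matrix.transpose_transpose]
  have hnn : 0 ≤ ((A - B) * (A - B)ᵀ).trace :=
    (Matrix.posSemidef_self_mul_conjTranspose (A - B)).trace_nonneg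
  have hexp : ((A - B) * (A - B)ᵀ).trace
      = (A * Aᵀ).trace + (B * Bᵀ).trace - 2 * (A * Bᵀ).trace := by
    simp only [Matrix.transpose_sub, Matrix.sub_mul, Matrix.mul_sub, Matrix.trace_sub, hcomm]
    ring
  have h0 : ((A - B) * (A - B)ᴴ).trace = 0 := le_antisymm (hexp.trans_le (by linarith)) hnn
  exact sub_eq_zero.mp (Matrix.trace_mul_conjTranspose_self_eq_zero_iff.mp h0)

/-- The equality case of von Neumann's trace inequality. -/
theorem trace_mul_transpose_eq_sum_singularValues_iff [DecidableEq J] (A B : Matrix (Fin m) J ℝ) :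
    (A * Bᵀ).trace = ∑ k, singularValues A k * singularValues B k ↔
      ∃ (U : Matrix (Fin m) (Fin m) ℝ) (V : Matrix J J ℝ), U * Uᵀ = 1 ∧ V * Vᵀ = 1 ∧
        A = U * rectDiagJ (J := J) (singularValues A) * Vᵀ ∧
        B = U * rectDiagJ (J := J) (singularValues B) * Vᵀ := by
  constructor
  · intro hAB
    obtain ⟨U, V, hU, hV, hC⟩ := exists_svd (A + B)
    refine ⟨U, V, hU, hV, ?_⟩
    have key := trace_svd_mul_svd_transpose_singularValues hU hV
    have hCA := key (A + B) A
    have hCB := key (A + B) B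
    rw [← hC] at hCA hCB
    have hAA := key A A
    have hABs := key A B
    have hBA := key B A
    have hBB := key B B
    have bA := trace_mul_svd_transpose_le B hU hV (singularValues_antitone A)
      (singularValues_nonneg A)
    have bB := trace_mul_svd_transpose_le A hU hV (singularValues_antitone B)
      (singularValues_nonneg B)
    set S := U * rectDiagJ (J := J) (singularValues A) * Vᵀ
    set T := U * rectDiagJ (J := J) (singularValues B) * Vᵀ
    have nA := sum_sq_singularValues A
    have nB := sum_sq_singularValues B
    simp only [sq] at nA nB
    have hsymm : ∑ k, singularValues B k * singularValues A k
        = ∑ k, singularValues A k * singularValues B k :=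
      Finset.sum_congr rfl fun k _ => mul_comm _ _
    have hcomm : (B * Aᵀ).trace = (A * Bᵀ).trace := by
      rw [← Matrix.trace_transpose, Matrix.transpose_mul, Matrix.transpose_transpose]
    have v1 := trace_mul_transpose_le_sum_singularValues (A + B) A
    have v2 := trace_mul_transpose_le_sum_singularValues (A + B) B
    have hST : A + B = S + T := by
      apply eq_of_trace_mul_transpose_le
      simp only [Matrix.transpose_add, Matrix.add_mul, Matrix.mul_add, Matrix.trace_add]
        at v1 v2 hCA hCB ⊢
      linarith
    have hS : (A * Sᵀ).trace + (B * Sᵀ).trace = (S * Sᵀ).trace + (T * Sᵀ).trace := by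
      rw [← Matrix.trace_add, ← Matrix.trace_add, ← Matrix.add_mul, ← Matrix.add_mul, hST]
    have hAS : A = S := eq_of_trace_mul_transpose_le (by linarith)
    exact ⟨hAS, add_left_cancel (hST.trans (by rw [hAS]))⟩
  · rintro ⟨U, V, hU, hV, hA, hB⟩
    have h := trace_svd_mul_svd_transpose_singularValues hU hV A B
    rwa [← hA, ← hB] at h

end SingularValues

theorem tinner_eq_trace_matricize (X Y : (∀ d, Fin (n d)) → ℝ) (d : Fin D) :
    tinner X Y = (matricize X d * (matricize Y d)ᵀ).trace := by
  simp only [Matrix.trace, Matrix.diag_apply, Matrix.mul_apply, Matrix.transpose_apply]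
  rw [← Fintype.sum_prod_type', tinner,
    ← Equiv.sum_comp (Equiv.piSplitAt d fun d => Fin (n d)).symm]
  refine Finset.sum_congr rfl fun p _ => ?_
  have h : (Equiv.piSplitAt d fun d => Fin (n d)).symm p = fun d' =>
      if h : d' = d then Fin.cast (congrArg n h.symm) p.1 else p.2 ⟨d', h⟩ := by
    ext d'
    simp only [Equiv.piSplitAt, Equiv.coe_fn_symm_mk]
    split_ifs with h
    · subst h; rfl
    · rfl
  rw [h]
  rfl

/-- simultaneous equality in all modes iff simultaneous ordered SVDs
of all matricizations. -/
theorem tensor_equality_iff_simultaneous_SVD (D : ℕ) (hD : 1 ≤ D) (n : Fin D → ℕ)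
    (X Y : (∀ d, Fin (n d)) → ℝ) :
    (∀ d : Fin D, tinner X Y = ∑ k : Fin (n d), modeSV X d k * modeSV Y d k) ↔
      (∀ d : Fin D,
        ∃ (U : Matrix (Fin (n d)) (Fin (n d)) ℝ)
          (V : Matrix (∀ d' : {d' : Fin D // d' ≠ d}, Fin (n d'))
                      (∀ d' : {d' : Fin D // d' ≠ d}, Fin (n d')) ℝ),
          U * Uᵀ = 1 ∧ V * Vᵀ = 1 ∧
          matricize X d = U * rectDiagJ (modeSV X d) * Vᵀ ∧
          matricize Y d = U * rectDiagJ (modeSV Y d) * Vᵀ) := by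
  refine forall_congr' fun d => ?_
  rw [tinner_eq_trace_matricize X Y d]
  exact trace_mul_transpose_eq_sum_singularValues_iff (matricize X d) (matricize Y d)
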